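/- arXiv:2207.08906 — 3 statements merged into one kernel-verified Lean document; each statement's English description precedes it below -/
import Mathlib

section
/- Let m ≥ 1, let a_1,…,a_{2m} be positive integers, and let (c_1,…,c_k) be the Hirzebruch conversion of (a_1,…,a_{2m}). Then, in ℤ[q,q⁻¹] (embedding ℤ[q] canonically), one has K_{2m}(a_1,…,a_{2m})_q = E_k(c_1,…,c_k)_q and K_{2m−1}(a_2,…,a_{2m})_q = E_{k−1}(c_2,…,c_k)_q. -/
/-- The `q`-integer `[c]_q = 1 + q + ⋯ + q^{c-1}` in `ℤ[q]`. -/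
noncomputable def qN (c : ℕ) : Polynomial ℤ := ∑ i ∈ Finset.range c, Polynomial.X ^ i

/-- The tridiagonal matrix whose determinant is the `q`-continuant
`E_k(c_1,…,c_k)_q` (here `c` is 0-indexed: `c 0 = c_1`). -/
noncomputable def Emat (k : ℕ) (c : ℕ → ℕ) : Matrix (Fin k) (Fin k) (Polynomial ℤ) :=
  Matrix.of fun i j =>
    if (i : ℕ) = (j : ℕ) then qN (c i)
    else if (j : ℕ) = (i : ℕ) + 1 then Polynomial.X ^ (c i - 1)
    else if (i : ℕ) = (j : ℕ) + 1 then 1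
    else 0

/-- The `q`-continuant `E_k(c_1,…,c_k)_q ∈ ℤ[q]` (0-indexed `c`); `Econt 0 c = 1`. -/
noncomputable def Econt (k : ℕ) (c : ℕ → ℕ) : Polynomial ℤ := (Emat k c).det

/-- The matrix `M(c_1,…,c_k)_q = ∏_{i=1}^{k} [[ [c_i]_q, −q^{c_i−1} ], [1, 0]]` over `ℤ[q]`. -/
noncomputable def Mmat (k : ℕ) (c : ℕ → ℕ) : Matrix (Fin 2) (Fin 2) (Polynomial ℤ) :=
  ((List.range k).map fun i => !![qN (c i), -(Polynomial.X ^ (c i - 1)); 1, 0]).prod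

open LaurentPolynomial in
/-- The `q`-integer `[c]_q = 1 + q + ⋯ + q^{c-1}` in `ℤ[q,q⁻¹]`. -/
noncomputable def qLp (c : ℕ) : LaurentPolynomial ℤ := ∑ i ∈ Finset.range c, T (i : ℤ)

open LaurentPolynomial in
/-- The `q`-integer `[c]_{q⁻¹} = 1 + q⁻¹ + ⋯ + q^{−(c−1)}` in `ℤ[q,q⁻¹]`. -/
noncomputable def qLm (c : ℕ) : LaurentPolynomial ℤ := ∑ i ∈ Finset.range c, T (-(i : ℤ))

open LaurentPolynomial in
/-- The tridiagonal matrix of size `n` whose rows/columns correspond to the paper's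
(1-indexed) positions `s+1, …, s+n` of the tuple `a` (0-indexed: `a 0 = a_1`):
diagonal entry at position `p` is `[a_p]_q` for `p` odd (1-indexed), `[a_p]_{q⁻¹}` for `p` even;
the `(p, p+1)` entry is `q^{a_p}` for `p` odd and `q^{−a_p}` for `p` even; subdiagonal entries
are `−1`. Here a 0-indexed position `(i : ℕ) + s` is even iff the 1-indexed position is odd. -/
noncomputable def Kmat (n s : ℕ) (a : ℕ → ℕ) : Matrix (Fin n) (Fin n) (LaurentPolynomial ℤ) :=
  Matrix.of fun i j =>
    if (i : ℕ) = (j : ℕ) then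
      (if ((i : ℕ) + s) % 2 = 0 then qLp (a ((i : ℕ) + s)) else qLm (a ((i : ℕ) + s)))
    else if (j : ℕ) = (i : ℕ) + 1 then
      (if ((i : ℕ) + s) % 2 = 0 then T ((a ((i : ℕ) + s) : ℤ)) else T (-(a ((i : ℕ) + s) : ℤ)))
    else if (i : ℕ) = (j : ℕ) + 1 then -1
    else 0

/-- The sum `a_2 + a_4 + ⋯ + a_{2m}` of even-position entries (0-indexed `a`). -/
noncomputable def Ksum (m : ℕ) (a : ℕ → ℕ) : ℤ := ∑ j ∈ Finset.range m, (a (2 * j + 1) : ℤ)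

open LaurentPolynomial in
/-- The `q`-continuant `K_{2m}(a_1,…,a_{2m})_q ∈ ℤ[q,q⁻¹]` (0-indexed `a`). -/
noncomputable def Kcont (m : ℕ) (a : ℕ → ℕ) : LaurentPolynomial ℤ :=
  T (Ksum m a - 1) * (Kmat (2 * m) 0 a).det

open LaurentPolynomial in
/-- The `q`-continuant `K_{2m−1}(a_2,…,a_{2m})_q ∈ ℤ[q,q⁻¹]` (same prefactor, first
row and column removed). -/
noncomputable def Kcont' (m : ℕ) (a : ℕ → ℕ) : LaurentPolynomial ℤ :=
  T (Ksum m a - 1) * (Kmat (2 * m - 1) 1 a).det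

open LaurentPolynomial in
/-- The elementary factor `A_i` of `M^+`: for a 0-indexed position `i` (1-indexed `i+1`),
`A = [[ [a_i]_q, q^{a_i} ], [1,0]]` at odd 1-indexed positions and
`A = [[ [a_i]_{q⁻¹}, q^{−a_i} ], [1,0]]` at even 1-indexed positions. -/
noncomputable def MplusF (a : ℕ → ℕ) (i : ℕ) : Matrix (Fin 2) (Fin 2) (LaurentPolynomial ℤ) :=
  if i % 2 = 0 then !![qLp (a i), T ((a i : ℤ)); 1, 0]
  else !![qLm (a i), T (-(a i : ℤ)); 1, 0]

open LaurentPolynomial in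
/-- The matrix `M^+(a_1,…,a_{2m})_q = q^{a_2+⋯+a_{2m}} ∏_{i=1}^{2m} A_i` over `ℤ[q,q⁻¹]`. -/
noncomputable def Mplus (m : ℕ) (a : ℕ → ℕ) : Matrix (Fin 2) (Fin 2) (LaurentPolynomial ℤ) :=
  (T (Ksum m a) : LaurentPolynomial ℤ) • ((List.range (2 * m)).map (MplusF a)).prod

/-- The Hirzebruch conversion of `(a_1,…,a_{2m})` (0-indexed `a`): the list
`(a_1+1, 2,…,2 (a_2−1 times), a_3+2, 2,…,2 (a_4−1 times), …, a_{2m−1}+2, 2,…,2 (a_{2m}−1 times))`,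
of length `a_2 + a_4 + ⋯ + a_{2m}`. -/
def hirz (m : ℕ) (a : ℕ → ℕ) : List ℕ :=
  ((List.range m).map fun j =>
    (if j = 0 then a 0 + 1 else a (2 * j) + 2) :: List.replicate (a (2 * j + 1) - 1) 2).flatten

/-- Pair of continuants (of the whole sequence, and of the sequence with its first entry removed). -/
def kp {R : Type*} [CommRing R] (l : R) : ℕ → (ℕ → R) → (ℕ → R) → R × R
  | 0, _, _ => (1, 0)
  | n + 1, d, u =>
    (d 0 * (kp l n (fun i => d (i + 1)) (fun i => u (i + 1))).1
      - u 0 * l * (kp l n (fun i => d (i + 1)) (fun i => u (i + 1))).2,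
     (kp l n (fun i => d (i + 1)) (fun i => u (i + 1))).1)

/-- A general tridiagonal matrix. -/
def tri {R : Type*} [CommRing R] (l : R) (n : ℕ) (d u : ℕ → R) : Matrix (Fin n) (Fin n) R :=
  Matrix.of fun i j =>
    if (i : ℕ) = (j : ℕ) then d i
    else if (j : ℕ) = (i : ℕ) + 1 then u i
    else if (i : ℕ) = (j : ℕ) + 1 then l
    else 0

lemma tri_sub {R : Type*} [CommRing R] (l : R) (n : ℕ) (d u : ℕ → R) :
    (tri l (n + 1) d u).submatrix Fin.succ Fin.succ
      = tri l n (fun i => d (i + 1)) (fun i => u (i + 1)) := by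
  ext i j
  simp [tri]

lemma tri_det_rec {R : Type*} [CommRing R] (l : R) (n : ℕ) (d u : ℕ → R) :
    (tri l (n + 2) d u).det = d 0 * (tri l (n + 1) (fun i => d (i + 1)) (fun i => u (i + 1))).det
      - u 0 * l * (tri l n (fun i => d (i + 2)) (fun i => u (i + 2))).det := by
  rw [Matrix.det_succ_column_zero, Fin.sum_univ_succ, Fin.sum_univ_succ, Finset.sum_eq_zero]
  · have h1 : (tri l (n + 2) d u).submatrix (Fin.succAbove 0) Fin.succ
      = tri l (n + 1) (fun i => d (i + 1)) (fun i => u (i + 1)) := by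
      rw [← tri_sub]; rfl
    have h2 : ((tri l (n + 2) d u).submatrix (Fin.succAbove (Fin.succ 0)) Fin.succ).det
      = u 0 * (tri l n (fun i => d (i + 2)) (fun i => u (i + 2))).det := by
      rw [Matrix.det_succ_row_zero, Fin.sum_univ_succ, Finset.sum_eq_zero]
      · have h3 : (((tri l (n + 2) d u).submatrix (Fin.succAbove (Fin.succ 0)) Fin.succ).submatrix
            Fin.succ (Fin.succAbove 0)) = tri l n (fun i => d (i + 2)) (fun i => u (i + 2)) := by
          rw [← tri_sub l n (fun i => d (i + 1)) (fun i => u (i + 1)), ← tri_sub]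
          ext i j
          simp [Fin.succAbove, Fin.lt_def]
        rw [h3]
        simp [tri, Fin.succAbove]
      · intro j _
        have : ((tri l (n + 2) d u).submatrix (Fin.succAbove (Fin.succ 0)) Fin.succ) 0 j.succ = 0 := by
          simp [tri, Fin.succAbove]
        rw [this]; ring
    rw [h1, h2]
    simp [tri]
    ring
  · intro j _
    have : (tri l (n + 2) d u) j.succ.succ 0 = 0 := by
      simp [tri]
    rw [this]; ring

lemma tri_det {R : Type*} [CommRing R] (l : R) : ∀ (n : ℕ) (d u : ℕ → R),
    (tri l n d u).det = (kp l n d u).1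
  | 0, d, u => by simp [kp]
  | 1, d, u => by simp [kp, tri]
  | n + 2, d, u => by
    rw [tri_det_rec, tri_det l (n + 1), tri_det l n]
    simp [kp]

open LaurentPolynomial

/-- continuant pair of a list -/
noncomputable def P (l : List ℕ) : LaurentPolynomial ℤ × LaurentPolynomial ℤ :=
  kp 1 l.length (fun i => qLp (l.getD i 0)) (fun i => T ((l.getD i 0 - 1 : ℕ) : ℤ))

lemma P_cons (c : ℕ) (l : List ℕ) :
    P (c :: l) = (qLp c * (P l).1 - T ((c - 1 : ℕ) : ℤ) * (P l).2, (P l).1) := by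
  simp [P, kp]

lemma Econt_eq (k : ℕ) (c : ℕ → ℕ) : Polynomial.toLaurent (Econt k c)
    = (kp 1 k (fun i => qLp (c i)) (fun i => T ((c i - 1 : ℕ) : ℤ))).1 := by
  rw [← tri_det, Econt, RingHom.map_det]
  congr 1
  ext1 i j
  simp only [tri, Emat, RingHom.mapMatrix_apply, Matrix.map_apply, Matrix.of_apply]
  split_ifs <;> simp [qN, qLp]

noncomputable def kd (a : ℕ → ℕ) (i : ℕ) : LaurentPolynomial ℤ :=
  if i % 2 = 0 then qLp (a i) else qLm (a i)

noncomputable def ku (a : ℕ → ℕ) (i : ℕ) : LaurentPolynomial ℤ :=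
  if i % 2 = 0 then T (a i : ℤ) else T (-(a i : ℤ))

noncomputable def Q (m : ℕ) (a : ℕ → ℕ) : LaurentPolynomial ℤ × LaurentPolynomial ℤ :=
  kp (-1) (2 * m) (kd a) (ku a)

lemma kd_shift (a : ℕ → ℕ) : (fun i => kd a (i + 2)) = kd (fun i => a (i + 2)) := by
  ext1 i; simp [kd]

lemma ku_shift (a : ℕ → ℕ) : (fun i => ku a (i + 2)) = ku (fun i => a (i + 2)) := by
  ext1 i; simp [ku]

lemma Q_succ (m : ℕ) (a : ℕ → ℕ) : Q (m + 1) a =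
    (qLp (a 0) * (qLm (a 1) * (Q m (fun i => a (i + 2))).1
        + T (-(a 1 : ℤ)) * (Q m (fun i => a (i + 2))).2)
      + T (a 0 : ℤ) * (Q m (fun i => a (i + 2))).1,
     qLm (a 1) * (Q m (fun i => a (i + 2))).1
        + T (-(a 1 : ℤ)) * (Q m (fun i => a (i + 2))).2) := by
  have h : 2 * (m + 1) = 2 * m + 1 + 1 := by ring
  have h1 : (fun i => kd a (i + 1 + 1)) = kd (fun i => a (i + 2)) := kd_shift a
  have h2 : (fun i => ku a (i + 1 + 1)) = ku (fun i => a (i + 2)) := ku_shift a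
  simp only [Q, h, kp, h1, h2]
  generalize kp (-1) (2 * m) (kd fun i => a (i + 2)) (ku fun i => a (i + 2)) = k
  simp [kd, ku]

lemma Kmat_zero (m : ℕ) (a : ℕ → ℕ) : (Kmat (2 * m) 0 a).det = (Q m a).1 := by
  rw [Q, ← tri_det]; rfl

lemma Kmat_one (m : ℕ) (a : ℕ → ℕ) : (Kmat (2 * (m + 1) - 1) 1 a).det = (Q (m + 1) a).2 := by
  have h : 2 * (m + 1) = 2 * m + 1 + 1 := by ring
  rw [Q, h, kp, ← tri_det]; rfl

lemma Ksum_succ (m : ℕ) (a : ℕ → ℕ) :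
    Ksum (m + 1) a = a 1 + Ksum m (fun i => a (i + 2)) := by
  rw [Ksum, Finset.sum_range_succ', add_comm]
  rfl

/-- uniform version of `hirz`. -/
def H (m : ℕ) (a : ℕ → ℕ) : List ℕ :=
  ((List.range m).map fun j =>
    (a (2 * j) + 2) :: List.replicate (a (2 * j + 1) - 1) 2).flatten

lemma H_succ (m : ℕ) (a : ℕ → ℕ) : H (m + 1) a =
    (a 0 + 2) :: (List.replicate (a 1 - 1) 2 ++ H m (fun i => a (i + 2))) := by
  simp [H, List.range_succ_eq_map, Function.comp_def, Nat.mul_add, add_right_comm]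

lemma hirz_succ (m : ℕ) (a : ℕ → ℕ) : hirz (m + 1) a =
    (a 0 + 1) :: (List.replicate (a 1 - 1) 2 ++ H m (fun i => a (i + 2))) := by
  simp [hirz, H, List.range_succ_eq_map, Function.comp_def, Nat.mul_add, add_right_comm]

lemma qLp_succ (c : ℕ) : qLp (c + 1) = qLp c + T (c : ℤ) := by
  simp [qLp, Finset.sum_range_succ]

lemma qLp_succ' (c : ℕ) : qLp (c + 1) = T 1 * qLp c + 1 := by
  rw [qLp, Finset.sum_range_succ', qLp, Finset.mul_sum]
  congr 1
  refine Finset.sum_congr rfl fun i _ => ?_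
  rw [← T_add]
  congr 1
  push_cast
  ring

lemma qLm_eq (c : ℕ) : T (c : ℤ) * qLm c = T 1 * qLp c := by
  induction c with
  | zero => simp [qLm, qLp]
  | succ c ih =>
    have h : qLm (c + 1) = qLm c + T (-(c : ℤ)) := by simp [qLm, Finset.sum_range_succ]
    rw [h, qLp_succ', mul_add, mul_add, ← ih, ← T_add, ← mul_assoc, ← T_add]
    congr 1
    · congr 2; push_cast; ring
    · simp

lemma P_rep (r : ℕ) (l : List ℕ) : P (List.replicate r 2 ++ l) =
    ((P l).1 + T 1 * qLp r * ((P l).1 - (P l).2), (P l).2 + qLp r * ((P l).1 - (P l).2)) := by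
  induction r with
  | zero => simp [qLp]
  | succ r ih =>
    have h2 : qLp 2 = 1 + T 1 := by simp [qLp, Finset.sum_range_succ]
    rw [List.replicate_succ, List.cons_append, P_cons, ih, h2, qLp_succ']
    ext1
    · simp; ring
    · simp; ring

lemma step (m : ℕ) (a : ℕ → ℕ) (h1 : 0 < a 1)
    (ih : P (H m (fun i => a (i + 2))) =
      (T (Ksum m (fun i => a (i + 2))) * ((Q m (fun i => a (i + 2))).1
        + T (-1) * (Q m (fun i => a (i + 2))).2),
       T (Ksum m (fun i => a (i + 2))) * (T (-1) * (Q m (fun i => a (i + 2))).2))) :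
    P (hirz (m + 1) a) = (T (Ksum (m + 1) a - 1) * (Q (m + 1) a).1,
      T (Ksum (m + 1) a - 1) * (Q (m + 1) a).2) := by
  obtain ⟨r, hr⟩ : ∃ r, a 1 = r + 1 := ⟨a 1 - 1, by omega⟩
  have hm := qLm_eq (a 1)
  rw [hirz_succ, P_cons, P_rep, ih, Ksum_succ, Q_succ]
  generalize Q m (fun i => a (i + 2)) = k
  generalize Ksum m (fun i => a (i + 2)) = N
  obtain ⟨k, k'⟩ := k
  have e1 : (T ((a 1 : ℤ) + N - 1) : LaurentPolynomial ℤ) = T (a 1 : ℤ) * T N * T (-1) := by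
    rw [← T_add, ← T_add]; rfl
  have i1 : (T 1 * T (-1) : LaurentPolynomial ℤ) = 1 := by rw [← T_add]; simp
  have i2 : (T (a 1 : ℤ) * T (-(a 1 : ℤ)) : LaurentPolynomial ℤ) = 1 := by rw [← T_add]; simp
  have e2 : (T (a 1 : ℤ) : LaurentPolynomial ℤ) = T 1 * T (r : ℤ) := by
    rw [← T_add, hr]; congr 1; push_cast; ring
  have e3 : qLp (a 1) = T 1 * qLp r + 1 := by rw [hr, qLp_succ']
  have e4 : T 1 * qLp r + 1 = qLp r + T (r : ℤ) := by rw [← qLp_succ', qLp_succ]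
  have e5 : a 1 - 1 = r := by omega
  rw [e1, e5, qLp_succ (a 0)]
  have hs : T (a 1 : ℤ) * T N * T (-1) * (qLm (a 1) * k + T (-(a 1 : ℤ)) * k')
      = T N * (k + T (-1) * k') + T 1 * qLp r * (T N * k) := by
    rw [e3] at hm
    linear_combination (T N * T (-1) * k) * hm + (T N * T (-1) * k') * i2
      + (T N * k * (T 1 * qLp r + 1)) * i1
  ext1
  · simp only [Nat.add_sub_cancel]
    linear_combination (-qLp (a 0)) * hs - (T N * T (-1) * T (a 0 : ℤ) * k) * e2
      - (T N * T (a 0 : ℤ) * k * T (r : ℤ)) * i1 + (T N * T (a 0 : ℤ) * k) * e4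
  · simp only
    linear_combination -hs

lemma P_H (m : ℕ) : ∀ (a : ℕ → ℕ), (∀ i < 2 * m, 0 < a i) → P (H m a) =
    (T (Ksum m a) * ((Q m a).1 + T (-1) * (Q m a).2), T (Ksum m a) * (T (-1) * (Q m a).2)) := by
  induction m with
  | zero => intro a _; simp [H, P, Q, kp, Ksum]
  | succ m ih =>
    intro a ha
    have h := step m a (ha 1 (by omega)) (ih _ fun i hi => ha _ (by omega))
    rw [hirz_succ, P_cons] at h
    rw [H_succ, P_cons, qLp_succ']
    obtain ⟨h1, h2⟩ := Prod.ext_iff.1 h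
    simp only [Nat.add_sub_cancel] at h1 h2
    have e1 : (T (Ksum (m + 1) a - 1) : LaurentPolynomial ℤ) = T (Ksum (m + 1) a) * T (-1) := by
      rw [← T_add]; rfl
    have i1 : (T 1 * T (-1) : LaurentPolynomial ℤ) = 1 := by rw [← T_add]; simp
    have e2 : (T ((a 0 + 2 - 1 : ℕ) : ℤ) : LaurentPolynomial ℤ) = T 1 * T (a 0 : ℤ) := by
      rw [← T_add]; congr 1; push_cast [show a 0 + 2 - 1 = a 0 + 1 by omega]; ring
    rw [e1] at h1 h2
    rw [e2]
    ext1
    · simp only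
      linear_combination T 1 * h1 + h2 + (T (Ksum (m + 1) a) * (Q (m + 1) a).1) * i1
    · simp only
      linear_combination h2

/-- with `(c_1,…,c_k)` the Hirzebruch conversion of `(a_1,…,a_{2m})`, one has
`K_{2m}(a_1,…,a_{2m})_q = E_k(c_1,…,c_k)_q` and `K_{2m−1}(a_2,…,a_{2m})_q = E_{k−1}(c_2,…,c_k)_q`
in `ℤ[q,q⁻¹]` (embedding `ℤ[q]` canonically). -/
theorem K_eq_E_hirzebruch (m : ℕ) (hm : 1 ≤ m) (a : ℕ → ℕ) (ha : ∀ i < 2 * m, 0 < a i) :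
    Polynomial.toLaurent (Econt (hirz m a).length (fun i => (hirz m a).getD i 0)) =
        Kcont m a ∧
      Polynomial.toLaurent
          (Econt ((hirz m a).length - 1) (fun i => (hirz m a).getD (i + 1) 0)) =
        Kcont' m a := by
  obtain ⟨m, rfl⟩ : ∃ n, m = n + 1 := ⟨m - 1, by omega⟩
  have h := step m a (ha 1 (by omega)) (P_H m _ fun i hi => ha _ (by omega))
  obtain ⟨h1, h2⟩ := Prod.ext_iff.1 h
  refine ⟨?_, ?_⟩
  · rw [Econt_eq, Kcont, Kmat_zero]
    exact h1
  · rw [Econt_eq, Kcont', Kmat_one]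
    refine Eq.trans ?_ h2
    rw [hirz_succ]
    simp [P, kp]
end

section
/- Let m ≥ 1, let a_1,…,a_{2m} be positive integers, and let (c_1,…,c_k) be the Hirzebruch conversion of (a_1,…,a_{2m}). Then, in ℤ[q,q⁻¹] (embedding ℤ[q] canonically), Tr M^+(a_1,…,a_{2m})_q = Tr M(c_1+1, c_2,…,c_k)_q. -/
open LaurentPolynomial in
/-- The factor of `M` pushed to Laurent polynomials. -/
noncomputable def auxN (c : ℕ) : Matrix (Fin 2) (Fin 2) (LaurentPolynomial ℤ) :=
  !![qLp c, -(T ((c - 1 : ℕ) : ℤ)); 1, 0]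

/-- Hirzebruch conversion with first entry raised by one. -/
def auxH (m : ℕ) (a : ℕ → ℕ) : List ℕ :=
  ((List.range m).map fun j =>
    (a (2 * j) + 2) :: List.replicate (a (2 * j + 1) - 1) 2).flatten

lemma aux_range (l : List ℕ) : (List.range l.length).map (fun i => l.getD i 0) = l := by
  apply List.ext_getElem
  · simp
  · intro i h1 h2
    simp [h2]

lemma aux_toLaurent (c : ℕ) :
    (Polynomial.toLaurent (R := ℤ)).mapMatrix !![qN c, -(Polynomial.X ^ (c - 1)); 1, 0] = auxN c := by
  ext1 i j
  fin_cases i <;> fin_cases j <;> simp [auxN, qN, qLp, map_sum]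

open LaurentPolynomial in
lemma aux_q (a : ℕ) : (T (a : ℤ) : LaurentPolynomial ℤ) = 1 + (T 1 - 1) * qLp a := by
  induction a with
  | zero => simp [qLp]
  | succ n ih =>
    have h : qLp (n + 1) = qLp n + T (n : ℤ) := by simp [qLp, Finset.sum_range_succ]
    have h2 : (T ((n + 1 : ℕ) : ℤ) : LaurentPolynomial ℤ) = T (n : ℤ) * T 1 := by
      rw [← T_add]; push_cast; rfl
    rw [h, h2]
    linear_combination ih

open LaurentPolynomial in
lemma aux_succ (n : ℕ) : qLp (n + 1) = qLp n + T (n : ℤ) := by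
  simp [qLp, Finset.sum_range_succ]

open LaurentPolynomial in
lemma aux_Tsucc (n : ℕ) : (T ((n + 1 : ℕ) : ℤ) : LaurentPolynomial ℤ) = T 1 * T (n : ℤ) := by
  rw [← T_add]; push_cast; rw [add_comm]

open LaurentPolynomial in
lemma aux_minus (b : ℕ) : (T (b : ℤ) : LaurentPolynomial ℤ) * qLm b = T 1 * qLp b := by
  induction b with
  | zero => simp [qLp, qLm]
  | succ n ih =>
    have h : qLm (n + 1) = qLm n + T (-(n : ℤ)) := by simp [qLm, Finset.sum_range_succ]
    have h3 : (T (n : ℤ) : LaurentPolynomial ℤ) * T (-(n : ℤ)) = 1 := by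
      rw [← T_add]; simp
    rw [h, aux_succ, aux_Tsucc]
    linear_combination (T 1) * ih + T 1 * h3 - T 1 * aux_q n

open LaurentPolynomial in
lemma aux_pow (n : ℕ) : auxN 2 ^ n =
    !![qLp (n + 1), 1 - qLp (n + 1); qLp n, 1 - qLp n] := by
  have h2 : qLp 2 = 1 + T 1 := by simp [qLp, Finset.sum_range_succ]
  induction n with
  | zero =>
    ext i j
    fin_cases i <;> fin_cases j <;> simp [qLp]
  | succ n ih =>
    rw [pow_succ', ih, auxN, h2, aux_succ (n + 1), aux_succ n, aux_Tsucc n, aux_q n]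
    ext1 i j
    fin_cases i <;> fin_cases j <;> simp [Matrix.mul_apply, Fin.sum_univ_two] <;> ring

open LaurentPolynomial in
/-- The conjugating matrix. -/
noncomputable def auxS : Matrix (Fin 2) (Fin 2) (LaurentPolynomial ℤ) := !![1, -1; 0, T 1]

open LaurentPolynomial in
lemma aux_block (a b : ℕ) (hb : 0 < b) :
    ((T (b : ℤ) : LaurentPolynomial ℤ) •
      (!![qLp a, T (a : ℤ); 1, 0] * !![qLm b, T (-(b : ℤ)); 1, 0])) * auxS =
    auxS * (auxN (a + 2) * auxN 2 ^ (b - 1)) := by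
  obtain ⟨n, rfl⟩ : ∃ n, b = n + 1 := ⟨b - 1, by omega⟩
  have h3 : (T ((n + 1 : ℕ) : ℤ) : LaurentPolynomial ℤ) * T (-((n + 1 : ℕ) : ℤ)) = 1 := by
    rw [← T_add]; simp
  have hm := aux_minus (n + 1)
  have hq := aux_q (n + 1)
  have hs : qLp (n + 1) = 1 + T 1 * qLp n := by
    rw [aux_succ, aux_q n]; ring
  have ht : (T ((a + 2 - 1 : ℕ) : ℤ) : LaurentPolynomial ℤ) = T 1 * T (a : ℤ) := aux_Tsucc a
  rw [Nat.add_sub_cancel, aux_pow, auxN, ht, aux_succ (a + 1), aux_succ a, aux_Tsucc a, auxS]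
  generalize (T ((n + 1 : ℕ) : ℤ) : LaurentPolynomial ℤ) = B at *
  generalize (T (-((n + 1 : ℕ) : ℤ)) : LaurentPolynomial ℤ) = B' at *
  rw [aux_q a]
  generalize qLp a = x at *
  generalize qLm (n + 1) = y' at *
  rw [hs] at hm hq ⊢
  generalize qLp n = z at *
  generalize (T 1 : LaurentPolynomial ℤ) = q at *
  have e : (B • (!![x, 1 + (q - 1) * x; 1, 0] * !![y', B'; 1, 0]) :
      Matrix (Fin 2) (Fin 2) (LaurentPolynomial ℤ)) =
      !![x * (q * (1 + q * z)) + (1 + (q - 1) * x) * (1 + (q - 1) * (1 + q * z)), x;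
        q * (1 + q * z), 1] := by
    ext1 i j
    fin_cases i <;> fin_cases j <;> simp [Matrix.mul_apply, Fin.sum_univ_two]
    · linear_combination x * hm + (1 + (q - 1) * x) * hq
    · linear_combination x * h3
    · linear_combination hm
    · linear_combination h3
  rw [e]
  ext1 i j
  fin_cases i <;> fin_cases j <;> simp [Matrix.mul_apply, Fin.sum_univ_two] <;> ring

open LaurentPolynomial in
lemma aux_conj (m : ℕ) (a : ℕ → ℕ) (ha : ∀ i < 2 * m, 0 < a i) :
    Mplus m a * auxS = auxS * ((auxH m a).map auxN).prod := by
  induction m with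
  | zero => simp [Mplus, Ksum, auxH]
  | succ m ih =>
    have ih' := ih (fun i hi => ha i (by omega))
    have hK : Ksum (m + 1) a = Ksum m a + (a (2 * m + 1) : ℤ) := by
      simp [Ksum, Finset.sum_range_succ]
    have hH : ((auxH (m + 1) a).map auxN).prod = ((auxH m a).map auxN).prod *
        (auxN (a (2 * m) + 2) * auxN 2 ^ (a (2 * m + 1) - 1)) := by
      simp [auxH, List.range_succ]
    have hM : Mplus (m + 1) a = Mplus m a * ((T (a (2 * m + 1) : ℤ) : LaurentPolynomial ℤ) •
      (!![qLp (a (2 * m)), T (a (2 * m) : ℤ); 1, 0] *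
        !![qLm (a (2 * m + 1)), T (-(a (2 * m + 1) : ℤ)); 1, 0])) := by
      have e0 : MplusF a (2 * m) = !![qLp (a (2 * m)), T (a (2 * m) : ℤ); 1, 0] := by
        simp [MplusF]
      have e1 : MplusF a (2 * m + 1) =
          !![qLm (a (2 * m + 1)), T (-(a (2 * m + 1) : ℤ)); 1, 0] := by
        rw [MplusF, if_neg (by omega)]
      rw [← e0, ← e1, Mplus, Mplus, hK, T_add, show 2 * (m + 1) = 2 * m + 1 + 1 by ring,
        List.range_succ, List.range_succ]
      simp only [List.map_append, List.prod_append, List.map_cons, List.map_nil, List.prod_cons,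
        List.prod_nil, mul_one, smul_mul_assoc, mul_smul_comm, smul_smul, mul_assoc]
      rw [mul_comm]
    rw [hM, hH, mul_assoc, aux_block _ _ (ha _ (by omega)), ← mul_assoc, ih', mul_assoc]

lemma aux_M (m : ℕ) (hm : 1 ≤ m) (a : ℕ → ℕ) :
    (Polynomial.toLaurent (R := ℤ)).mapMatrix (Mmat (hirz m a).length
        (fun i => if i = 0 then (hirz m a).getD 0 0 + 1 else (hirz m a).getD i 0)) =
      ((auxH m a).map auxN).prod := by
  obtain ⟨n, rfl⟩ : ∃ n, m = n + 1 := ⟨m - 1, by omega⟩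
  obtain ⟨r, h1, h2⟩ : ∃ r, hirz (n + 1) a = (a 0 + 1) :: r ∧ auxH (n + 1) a = (a 0 + 2) :: r := by
    refine ⟨List.replicate (a 1 - 1) 2 ++ ((List.range n).map fun j =>
      (a (2 * (j + 1)) + 2) :: List.replicate (a (2 * (j + 1) + 1) - 1) 2).flatten, ?_, ?_⟩
    · rw [hirz, List.range_succ_eq_map, List.map_cons, List.flatten_cons, List.cons_append]
      simp [Function.comp_def]
    · rw [auxH, List.range_succ_eq_map, List.map_cons, List.flatten_cons, List.cons_append]
      simp [Function.comp_def]
  have hf : (fun i => if i = 0 then (hirz (n + 1) a).getD 0 0 + 1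
      else (hirz (n + 1) a).getD i 0) = fun i => (auxH (n + 1) a).getD i 0 := by
    rw [h1, h2]
    funext i
    cases i <;> simp
  have hl : (hirz (n + 1) a).length = (auxH (n + 1) a).length := by simp [h1, h2]
  rw [hf, hl, Mmat, map_list_prod, List.map_map]
  conv_rhs => rw [← aux_range (auxH (n + 1) a), List.map_map]
  congr 1
  apply List.map_congr_left
  intro i _
  exact aux_toLaurent _

/-- with `(c_1,…,c_k)` the Hirzebruch conversion of `(a_1,…,a_{2m})`,
`Tr M^+(a_1,…,a_{2m})_q = Tr M(c_1+1, c_2,…,c_k)_q` in `ℤ[q,q⁻¹]`. -/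
theorem trace_Mplus_eq_trace_M (m : ℕ) (hm : 1 ≤ m) (a : ℕ → ℕ)
    (ha : ∀ i < 2 * m, 0 < a i) :
    Matrix.trace (Mplus m a) =
      Polynomial.toLaurent (Matrix.trace (Mmat (hirz m a).length
        (fun i => if i = 0 then (hirz m a).getD 0 0 + 1 else (hirz m a).getD i 0))) := by
  have h := aux_conj m a ha
  rw [← aux_M m hm a] at h
  set N := Mmat (hirz m a).length
    (fun i => if i = 0 then (hirz m a).getD 0 0 + 1 else (hirz m a).getD i 0)
  have ht : Polynomial.toLaurent (Matrix.trace N) =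
      Matrix.trace ((Polynomial.toLaurent (R := ℤ)).mapMatrix N) := by
    simp [Matrix.trace]
  let S' : Matrix (Fin 2) (Fin 2) (LaurentPolynomial ℤ) :=
    !![1, LaurentPolynomial.T (-1); 0, LaurentPolynomial.T (-1)]
  have hT : (LaurentPolynomial.T 1 : LaurentPolynomial ℤ) * LaurentPolynomial.T (-1) = 1 := by
    rw [← LaurentPolynomial.T_add]; simp
  have hS : auxS * S' = 1 := by
    ext1 i j
    fin_cases i <;> fin_cases j <;> simp [auxS, S', Matrix.mul_apply, Fin.sum_univ_two, hT]
  have hS2 : S' * auxS = 1 := mul_eq_one_comm.mp hS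
  rw [ht]
  calc Matrix.trace (Mplus m a) = Matrix.trace (Mplus m a * auxS * S') := by
        rw [mul_assoc, hS, mul_one]
    _ = _ := by rw [h, Matrix.trace_mul_comm, ← mul_assoc, hS2, one_mul]
end

section
/- For every k ≥ 2 and positive integers c_1,…,c_k, the q-rotundus satisfies R(c_1,…,c_k)_q := Tr M(c_1,…,c_k)_q = E_k(c_1,…,c_k)_q − q^{c_k−1}·E_{k−2}(c_2,…,c_{k−1})_q in ℤ[q]. -/
theorem Econt_rec (k : ℕ) (c : ℕ → ℕ) :
    Econt (k + 2) c = qN (c 0) * Econt (k + 1) (fun i => c (i + 1))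
      - Polynomial.X ^ (c 0 - 1) * Econt k (fun i => c (i + 2)) := by
  have h1 : (Emat (k + 2) c).submatrix Fin.succ (Fin.succAbove 0)
      = Emat (k + 1) (fun i => c (i + 1)) := by
    ext1 i j
    simp [Emat]
  have h2 : ((Emat (k + 2) c).submatrix Fin.succ (Fin.succAbove 1)).det
      = Econt k (fun i => c (i + 2)) := by
    rw [Matrix.det_succ_column_zero, Fin.sum_univ_succ, Finset.sum_eq_zero]
    · have h3 : ((Emat (k + 2) c).submatrix Fin.succ (Fin.succAbove 1)).submatrix
          (Fin.succAbove 0) Fin.succ = Emat k (fun i => c (i + 2)) := by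
        ext1 i j
        simp [Emat, Fin.succAbove, Fin.lt_def]
      rw [h3]
      simp [Emat, Econt, Fin.succAbove, Fin.lt_def]
    · intro i _
      simp [Emat, Fin.succAbove, Fin.lt_def]
  rw [Econt, Matrix.det_succ_row_zero, Fin.sum_univ_succ, Fin.sum_univ_succ, Finset.sum_eq_zero,
    h1]
  · have h4 : (Fin.succ 0 : Fin (k + 2)) = 1 := rfl
    rw [h4, h2]
    simp [Emat, Econt]
    ring
  · intro i _
    simp [Emat]

theorem Econt_zero (c : ℕ → ℕ) : Econt 0 c = 1 := by simp [Econt]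

theorem Econt_one (c : ℕ → ℕ) : Econt 1 c = qN (c 0) := by simp [Econt, Emat]

theorem Mmat_succ (k : ℕ) (c : ℕ → ℕ) :
    Mmat (k + 1) c = !![qN (c 0), -(Polynomial.X ^ (c 0 - 1)); 1, 0]
      * Mmat k (fun i => c (i + 1)) := by
  simp [Mmat, List.range_succ_eq_map, Function.comp_def]

theorem Mmat_eq (k : ℕ) : ∀ c : ℕ → ℕ,
    Mmat (k + 2) c = !![Econt (k + 2) c, -(Polynomial.X ^ (c (k + 1) - 1) * Econt (k + 1) c);
      Econt (k + 1) (fun i => c (i + 1)),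
      -(Polynomial.X ^ (c (k + 1) - 1) * Econt k (fun i => c (i + 1)))] := by
  induction k with
  | zero =>
    intro c
    rw [Mmat_succ, Mmat_succ, Econt_rec]
    simp [Mmat, Econt_zero, Econt_one]
    constructor <;> ring
  | succ k ih =>
    intro c
    rw [Mmat_succ, ih, Econt_rec (k + 1) c, Econt_rec k c, Matrix.mul_fin_two]
    ext1 i j
    fin_cases i <;> fin_cases j <;> simp <;> ring_nf

/-- for `k ≥ 2` and positive integers `c_1,…,c_k`, the `q`-rotundus satisfies
`Tr M(c_1,…,c_k)_q = E_k(c_1,…,c_k)_q − q^{c_k−1}·E_{k−2}(c_2,…,c_{k−1})_q` in `ℤ[q]`. -/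
theorem rotundus_eq_continuants (k : ℕ) (hk : 2 ≤ k) (c : ℕ → ℕ) (hc : ∀ i < k, 0 < c i) :
    Matrix.trace (Mmat k c) =
      Econt k c - Polynomial.X ^ (c (k - 1) - 1) * Econt (k - 2) (fun i => c (i + 1)) := by
  obtain ⟨n, rfl⟩ : ∃ n, k = n + 2 := ⟨k - 2, by omega⟩
  rw [Mmat_eq, Matrix.trace_fin_two]
  simp [sub_eq_add_neg]
end
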